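/- Let k ≥ 1 and let F(ξ₁,…,ξ_k) = ∑_{i=1}^k (1/π) log(2(1-ξ_i²)) + ∑_{i≠j} (-1)^{i+j} G(ξ_i,ξ_j) on the open set P_k = {(ξ₁,…,ξ_k) : -1 < ξ₁ < ξ₂ < … < ξ_k < 1}. Then F(ξ) → -∞ as dist(ξ, ∂P_k) → 0, and consequently F attains a global maximum in P_k, and the set of global maximum points of F in P_k is compact. -/

import Mathlib

open Real Finset

noncomputable def greenG (a b : ℝ) : ℝ :=
  (1 / π) * Real.log ((1 - a * b + Real.sqrt ((1 - a ^ 2) * (1 - b ^ 2))) / |b - a|)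

noncomputable def redFk (k : ℕ) (ξ : Fin k → ℝ) : ℝ :=
  (∑ i, (1 / π) * Real.log (2 * (1 - ξ i ^ 2))) +
    ∑ p ∈ (Finset.univ : Finset (Fin k)).offDiag,
      (-1 : ℝ) ^ ((p.1 : ℕ) + (p.2 : ℕ)) * greenG (ξ p.1) (ξ p.2)

def Pk (k : ℕ) : Set (Fin k → ℝ) :=
  {ξ | (∀ i, ξ i ∈ Set.Ioo (-1:ℝ) 1) ∧ ∀ i j : Fin k, i < j → ξ i < ξ j}

lemma alt_bound (n : ℕ) : ∀ a : ℕ → ℝ, (∀ j, 0 ≤ a j) → (∀ j, a (j+1) ≤ a j) →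
    0 ≤ ∑ j ∈ range n, (-1:ℝ)^j * a j ∧ ∑ j ∈ range n, (-1:ℝ)^j * a j ≤ a 0 := by
  induction n with
  | zero => intro a h0 _; simp [h0 0]
  | succ n ih =>
    intro a h0 h1
    have h := ih (fun j => a (j+1)) (fun j => h0 _) (fun j => h1 _)
    rw [Finset.sum_range_succ']
    have e : ∑ j ∈ range n, (-1:ℝ)^(j+1) * a (j+1) = - ∑ j ∈ range n, (-1:ℝ)^j * a (j+1) := by
      rw [← Finset.sum_neg_distrib]
      exact Finset.sum_congr rfl fun j _ => by ring
    rw [e]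
    have := h1 0
    simp only [zero_add] at h this
    simp only [pow_zero, one_mul]
    constructor <;> linarith [h.1, h.2]

lemma row_bound (k : ℕ) (g : ℕ → ℕ → ℝ) (H0 : ∀ i j, i < j → 0 ≤ g i j)
    (H1 : ∀ i j, i < j → g i (j+1) ≤ g i j) (H2 : ∀ i j, i + 1 < j → g i j ≤ g (i+1) j)
    (Hz : ∀ i j, k ≤ j → g i j = 0) (i : ℕ) (hi : i < k) :
    ∑ j ∈ Ico (i+1) k, (-1:ℝ)^(i+j) * g i j ≤ 0 ∧
    ∑ j ∈ Ico (i+1) k, (-1:ℝ)^(i+j) * g i j ≤ g (i+1) (i+2) - g i (i+1) := by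
  rw [Finset.sum_Ico_eq_sum_range]
  have e : ∀ j, (-1:ℝ)^(i+(i+1+j)) * g i (i+1+j) = - ((-1:ℝ)^j * g i (i+1+j)) := by
    intro j
    have : (-1:ℝ)^(i+(i+1+j)) = - (-1:ℝ)^j := by
      rw [show i+(i+1+j) = 2*i + (j+1) by ring, pow_add, pow_mul]; simp [pow_succ]
    rw [this]; ring
  simp only [e, Finset.sum_neg_distrib]
  have h1 := alt_bound (k-(i+1)) (fun j => g i (i+1+j)) (fun j => H0 i (i+1+j) (by omega))
    (fun j => H1 i (i+1+j) (by omega))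
  refine ⟨by linarith [h1.1], ?_⟩
  rcases Nat.eq_zero_or_pos (k-(i+1)) with h | h
  · rw [h, Hz _ (i+2) (by omega), Hz _ (i+1) (by omega)]; simp
  · obtain ⟨n, hn⟩ : ∃ n, k-(i+1) = n+1 := ⟨k-(i+1)-1, by omega⟩
    rw [hn, Finset.sum_range_succ']
    have h2 := alt_bound n (fun j => g i (i+2+j)) (fun j => H0 i (i+2+j) (by omega))
      (fun j => H1 i (i+2+j) (by omega))
    have e2 : ∑ j ∈ range n, (-1:ℝ)^(j+1) * g i (i+1+(j+1))
        = - ∑ j ∈ range n, (-1:ℝ)^j * g i (i+2+j) := by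
      rw [← Finset.sum_neg_distrib]
      refine Finset.sum_congr rfl fun j _ => ?_
      rw [show i+1+(j+1) = i+2+j by ring]; ring
    rw [e2]
    have := H2 i (i+2) (by omega)
    simp only [add_zero, pow_zero, one_mul] at h2 ⊢
    linarith [h2.2]

lemma tri_bound (k : ℕ) (g : ℕ → ℕ → ℝ) (H0 : ∀ i j, i < j → 0 ≤ g i j)
    (H1 : ∀ i j, i < j → g i (j+1) ≤ g i j) (H2 : ∀ i j, i + 1 < j → g i j ≤ g (i+1) j)
    (Hz : ∀ i j, k ≤ j → g i j = 0) :
    (∑ i ∈ range k, ∑ j ∈ Ico (i+1) k, (-1:ℝ)^(i+j) * g i j ≤ 0) ∧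
    ∀ m, m < k → ∑ i ∈ range k, ∑ j ∈ Ico (i+1) k, (-1:ℝ)^(i+j) * g i j ≤ - g m (m+1) := by
  have hr := row_bound k g H0 H1 H2 Hz
  refine ⟨Finset.sum_nonpos fun i hi => (hr i (by simpa using hi)).1, fun m hm => ?_⟩
  rw [← Finset.sum_range_add_sum_Ico _ hm.le]
  have a1 : ∑ i ∈ range m, ∑ j ∈ Ico (i+1) k, (-1:ℝ)^(i+j) * g i j ≤ 0 :=
    Finset.sum_nonpos fun i hi => (hr i (by have := Finset.mem_range.1 hi; omega)).1
  have a2 : ∑ i ∈ Ico m k, ∑ j ∈ Ico (i+1) k, (-1:ℝ)^(i+j) * g i j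
      ≤ ∑ i ∈ Ico m k, (g (i+1) (i+2) - g i (i+1)) :=
    Finset.sum_le_sum fun i hi => (hr i (Finset.mem_Ico.1 hi).2).2
  have a3 := Finset.sum_Ico_sub (fun i => g i (i+1)) hm.le
  have a4 := Hz k (k+1) (by omega)
  have a5 : ∑ i ∈ Ico m k, (g (i+1) (i+2) - g i (i+1)) = g k (k+1) - g m (m+1) := a3
  linarith

lemma offDiag_sum (k : ℕ) (f : ℕ → ℕ → ℝ) (hf : ∀ i j, f i j = f j i) :
    ∑ p ∈ (Finset.univ : Finset (Fin k)).offDiag, f p.1 p.2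
      = 2 * ∑ i ∈ range k, ∑ j ∈ Ico (i+1) k, f i j := by
  have s1 : ∑ p ∈ (Finset.univ : Finset (Fin k)).offDiag, f p.1 p.2
      = ∑ i : Fin k, ∑ j : Fin k, if (i:ℕ) ≠ j then f i j else 0 := by
    rw [← Fintype.sum_prod_type' (f := fun i j : Fin k => if (i:ℕ) ≠ j then f i j else 0),
      ← Finset.sum_filter]
    refine Finset.sum_congr ?_ fun _ _ => rfl
    ext p; simp [Fin.ext_iff]
  have s2 : ∑ i : Fin k, ∑ j : Fin k, (if (i:ℕ) ≠ j then f i j else 0)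
      = ∑ i : Fin k, ∑ j : Fin k, (if (i:ℕ) < j then f i j else 0)
        + ∑ i : Fin k, ∑ j : Fin k, (if (j:ℕ) < i then f j i else 0) := by
    rw [← Finset.sum_add_distrib]
    refine Finset.sum_congr rfl fun i _ => ?_
    rw [← Finset.sum_add_distrib]
    refine Finset.sum_congr rfl fun j _ => ?_
    rcases lt_trichotomy (i:ℕ) j with h | h | h
    · simp [h, h.ne, h.le.not_gt]
    · simp [h]
    · simp [h, h.ne', h.le.not_gt, hf]
  have s3 : ∑ i : Fin k, ∑ j : Fin k, (if (i:ℕ) < j then f i j else 0)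
      = ∑ i ∈ range k, ∑ j ∈ Ico (i+1) k, f i j := by
    rw [← Fin.sum_univ_eq_sum_range (fun i => ∑ j ∈ Ico (i+1) k, f i j)]
    refine Finset.sum_congr rfl fun i _ => ?_
    rw [Fin.sum_univ_eq_sum_range (fun j => if (i:ℕ) < j then f i j else 0), ← Finset.sum_filter]
    refine Finset.sum_congr ?_ fun _ _ => rfl
    ext j; simp; omega
  rw [s1, s2, Finset.sum_comm (f := fun i j : Fin k => if (j:ℕ) < i then f j i else 0), s3]
  ring

lemma greenG_comm (a b : ℝ) : greenG a b = greenG b a := by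
  unfold greenG
  rw [abs_sub_comm, mul_comm a b, mul_comm (1 - a^2)]

noncomputable def rr (a : ℝ) : ℝ := √(1+a) / √(1-a)

lemma rr_pos {a : ℝ} (h : a ∈ Set.Ioo (-1:ℝ) 1) : 0 < rr a :=
  div_pos (Real.sqrt_pos.2 (by linarith [h.1])) (Real.sqrt_pos.2 (by linarith [h.2]))

lemma rr_lt {a b : ℝ} (ha : a ∈ Set.Ioo (-1:ℝ) 1) (hb : b ∈ Set.Ioo (-1:ℝ) 1) (h : a < b) :
    rr a < rr b := by
  have h1 : √(1+a) < √(1+b) := Real.sqrt_lt_sqrt (by linarith [ha.1]) (by linarith)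
  have h2 : √(1-b) < √(1-a) := Real.sqrt_lt_sqrt (by linarith [hb.2]) (by linarith)
  exact div_lt_div₀ h1 h2.le (Real.sqrt_nonneg _) (Real.sqrt_pos.2 (by linarith [hb.2]))

lemma greenG_eq {a b : ℝ} (ha : a ∈ Set.Ioo (-1:ℝ) 1) (hb : b ∈ Set.Ioo (-1:ℝ) 1) (h : a < b) :
    greenG a b = (1/π) * Real.log ((rr b + rr a) / (rr b - rr a)) := by
  unfold greenG
  congr 2
  have hlt := rr_lt ha hb h
  rw [abs_of_pos (by linarith)]
  rw [div_eq_div_iff (by linarith) (by linarith)]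
  have e : √((1-a^2)*(1-b^2)) = √(1-a) * √(1+a) * (√(1-b) * √(1+b)) := by
    rw [← Real.sqrt_mul (by linarith [ha.2]), ← Real.sqrt_mul (by linarith [hb.2]),
      ← Real.sqrt_mul (by nlinarith [ha.1, ha.2])]
    ring_nf
  rw [e]
  unfold rr
  have u0 : 0 < √(1-a) := Real.sqrt_pos.2 (by linarith [ha.2])
  have w0 : 0 < √(1-b) := Real.sqrt_pos.2 (by linarith [hb.2])
  have u2 := Real.sq_sqrt (show 0 ≤ 1-a by linarith [ha.2])
  have w2 := Real.sq_sqrt (show 0 ≤ 1-b by linarith [hb.2])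
  have v2 := Real.sq_sqrt (show 0 ≤ 1+a by linarith [ha.1])
  have z2 := Real.sq_sqrt (show 0 ≤ 1+b by linarith [hb.1])
  generalize √(1-a) = u at *
  generalize √(1-b) = w at *
  generalize √(1+a) = v at *
  generalize √(1+b) = z at *
  field_simp
  have ea : a = 1 - u^2 := by linarith
  have eb : b = 1 - w^2 := by linarith
  have v2' : v^2 = 2 - u^2 := by linarith
  have z2' : z^2 = 2 - w^2 := by linarith
  subst ea eb
  have t1 : (1 - (1 - u^2) * (1 - w^2) + u*v*(w*z)) * 2 = (u*z+v*w)^2 := by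
    linear_combination (-w^2) * v2' - u^2 * z2'
  have t2 : ((1 - w^2) - (1 - u^2)) * 2 = (u*z+v*w)*(u*z-v*w) := by
    linear_combination (w^2) * v2' - u^2 * z2'
  linear_combination (1/2) * (u*z-v*w) * t1 - (1/2) * (u*z+v*w) * t2

lemma greenG_nonneg {a b : ℝ} (ha : a ∈ Set.Ioo (-1:ℝ) 1) (hb : b ∈ Set.Ioo (-1:ℝ) 1)
    (h : a < b) : 0 ≤ greenG a b := by
  rw [greenG_eq ha hb h]
  have := rr_lt ha hb h
  have := rr_pos ha
  refine mul_nonneg (by positivity) (Real.log_nonneg ?_)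
  rw [le_div_iff₀ (by linarith)]; linarith

lemma greenG_right {a b c : ℝ} (ha : a ∈ Set.Ioo (-1:ℝ) 1) (hb : b ∈ Set.Ioo (-1:ℝ) 1)
    (hc : c ∈ Set.Ioo (-1:ℝ) 1) (h : a < b) (h' : b < c) : greenG a c ≤ greenG a b := by
  rw [greenG_eq ha hb h, greenG_eq ha hc (h.trans h')]
  have := rr_lt ha hb h
  have := rr_lt hb hc h'
  have := rr_pos ha
  refine mul_le_mul_of_nonneg_left (Real.log_le_log (div_pos (by linarith) (by linarith)) ?_)
    (by positivity)
  rw [div_le_div_iff₀ (by linarith) (by linarith)]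
  nlinarith

lemma greenG_left {a b c : ℝ} (ha : a ∈ Set.Ioo (-1:ℝ) 1) (hb : b ∈ Set.Ioo (-1:ℝ) 1)
    (hc : c ∈ Set.Ioo (-1:ℝ) 1) (h : a < b) (h' : b < c) : greenG a c ≤ greenG b c := by
  rw [greenG_eq hb hc h', greenG_eq ha hc (h.trans h')]
  have := rr_lt ha hb h
  have := rr_lt hb hc h'
  have := rr_pos ha
  refine mul_le_mul_of_nonneg_left (Real.log_le_log (div_pos (by linarith) (by linarith)) ?_)
    (by positivity)
  rw [div_le_div_iff₀ (by linarith) (by linarith)]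
  nlinarith

lemma greenG_lower {a b : ℝ} (ha : a ∈ Set.Ioo (-1:ℝ) 1) (hb : b ∈ Set.Ioo (-1:ℝ) 1)
    (h : a < b) :
    Real.log (1-a^2) + Real.log (1-b^2) - 2 * (π * greenG a b) ≤ 2 * Real.log (b-a) := by
  have p1 : 0 < 1 - a^2 := by nlinarith [ha.1, ha.2]
  have p2 : 0 < 1 - b^2 := by nlinarith [hb.1, hb.2]
  have p3 : 0 < 1 - a*b := by nlinarith [ha.1, ha.2, hb.1, hb.2]
  have p4 : 0 < b - a := by linarith
  have e : π * greenG a b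
      = Real.log ((1 - a * b + Real.sqrt ((1 - a ^ 2) * (1 - b ^ 2))) / |b - a|) := by
    unfold greenG; field_simp
  have l1 : Real.log ((1-a*b)/(b-a)) ≤ π * greenG a b := by
    rw [e, abs_of_pos p4]
    refine Real.log_le_log (by positivity) ?_
    gcongr
    linarith [Real.sqrt_nonneg ((1 - a ^ 2) * (1 - b ^ 2))]
  rw [Real.log_div p3.ne' p4.ne'] at l1
  have l2 : Real.log ((1-a^2)*(1-b^2)) ≤ Real.log ((1-a*b)^2) :=
    Real.log_le_log (by positivity) (by nlinarith [sq_nonneg (a-b)])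
  rw [Real.log_mul p1.ne' p2.ne', Real.log_pow] at l2
  push_cast at l2
  linarith

lemma off_bound {k : ℕ} {ξ : Fin k → ℝ} (hξ : ξ ∈ Pk k) :
    (∑ p ∈ (Finset.univ : Finset (Fin k)).offDiag,
      (-1 : ℝ) ^ ((p.1 : ℕ) + (p.2 : ℕ)) * greenG (ξ p.1) (ξ p.2) ≤ 0) ∧
    ∀ m : ℕ, ∀ h : m + 1 < k, ∑ p ∈ (Finset.univ : Finset (Fin k)).offDiag,
      (-1 : ℝ) ^ ((p.1 : ℕ) + (p.2 : ℕ)) * greenG (ξ p.1) (ξ p.2)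
        ≤ - 2 * greenG (ξ ⟨m, by omega⟩) (ξ ⟨m+1, h⟩) := by
  let g : ℕ → ℕ → ℝ := fun i j =>
    if h : i < k ∧ j < k then greenG (ξ ⟨i, h.1⟩) (ξ ⟨j, h.2⟩) else 0
  have hg : ∀ i j, ∀ hi : i < k, ∀ hj : j < k, g i j = greenG (ξ ⟨i, hi⟩) (ξ ⟨j, hj⟩) := by
    intro i j hi hj; simp [g, hi, hj]
  have hz : ∀ i j, k ≤ j → g i j = 0 := by
    intro i j hj; simp [g, hj.not_gt]
  have hs : ∀ i j, g i j = g j i := by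
    intro i j
    by_cases hi : i < k <;> by_cases hj : j < k <;> simp [g, hi, hj, greenG_comm]
  have hm : ∀ i j, ∀ hi : i < k, ∀ hj : j < k, i < j → ξ ⟨i, hi⟩ < ξ ⟨j, hj⟩ :=
    fun i j hi hj h => hξ.2 _ _ (by simpa using h)
  have H0 : ∀ i j, i < j → 0 ≤ g i j := by
    intro i j hij
    by_cases hj : j < k
    · rw [hg i j (by omega) hj]
      exact greenG_nonneg (hξ.1 _) (hξ.1 _) (hm _ _ _ _ hij)
    · rw [hz i j (by omega)]
  have H1 : ∀ i j, i < j → g i (j+1) ≤ g i j := by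
    intro i j hij
    by_cases hj : j + 1 < k
    · rw [hg i j (by omega) (by omega), hg i (j+1) (by omega) hj]
      exact greenG_right (hξ.1 _) (hξ.1 _) (hξ.1 _) (hm _ _ _ _ hij) (hm _ _ _ _ (by omega))
    · rw [hz i (j+1) (by omega)]; exact H0 _ _ hij
  have H2 : ∀ i j, i + 1 < j → g i j ≤ g (i+1) j := by
    intro i j hij
    by_cases hj : j < k
    · rw [hg i j (by omega) (by omega), hg (i+1) j (by omega) hj]
      exact greenG_left (hξ.1 _) (hξ.1 _) (hξ.1 _) (hm _ _ _ _ (by omega)) (hm _ _ _ _ hij)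
    · rw [hz i j (by omega)]; exact H0 _ _ hij
  have key := tri_bound k g H0 H1 H2 hz
  have e : ∑ p ∈ (Finset.univ : Finset (Fin k)).offDiag,
      (-1 : ℝ) ^ ((p.1 : ℕ) + (p.2 : ℕ)) * greenG (ξ p.1) (ξ p.2)
      = 2 * ∑ i ∈ range k, ∑ j ∈ Ico (i+1) k, (-1:ℝ)^(i+j) * g i j := by
    rw [← offDiag_sum k (fun i j => (-1:ℝ)^(i+j) * g i j)
      (fun i j => by rw [add_comm, hs])]
    refine Finset.sum_congr rfl fun p _ => ?_
    rw [hg _ _ p.1.2 p.2.2]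
  rw [e]
  refine ⟨by linarith [key.1], fun m h => ?_⟩
  have := key.2 m (by omega)
  rw [hg m (m+1) (by omega) h] at this
  linarith

lemma pi_redFk {k : ℕ} {ξ : Fin k → ℝ} (hξ : ξ ∈ Pk k) :
    π * redFk k ξ = k * Real.log 2 + ∑ i, Real.log (1 - ξ i ^ 2) +
      π * ∑ p ∈ (Finset.univ : Finset (Fin k)).offDiag,
      (-1 : ℝ) ^ ((p.1 : ℕ) + (p.2 : ℕ)) * greenG (ξ p.1) (ξ p.2) := by
  unfold redFk
  rw [mul_add, ← Finset.mul_sum, ← mul_assoc, mul_one_div_cancel Real.pi_ne_zero, one_mul]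
  congr 1
  have : ∀ i, Real.log (2 * (1 - ξ i ^ 2)) = Real.log 2 + Real.log (1 - ξ i ^ 2) := by
    intro i
    have := hξ.1 i
    exact Real.log_mul (by norm_num) (by nlinarith [this.1, this.2])
  simp [this, Finset.sum_add_distrib]

lemma log_term_nonpos {a : ℝ} (ha : a ∈ Set.Ioo (-1:ℝ) 1) : Real.log (1 - a^2) ≤ 0 :=
  Real.log_nonpos (by nlinarith [ha.1, ha.2]) (by nlinarith [sq_nonneg a])

lemma bound_one {k : ℕ} {ξ : Fin k → ℝ} (hξ : ξ ∈ Pk k) (i : Fin k) :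
    π * redFk k ξ ≤ k * Real.log 2 + Real.log (1 - ξ i ^ 2) := by
  rw [pi_redFk hξ]
  have h1 := mul_nonpos_of_nonneg_of_nonpos Real.pi_pos.le (off_bound hξ).1
  have h2 : ∑ j, Real.log (1 - ξ j ^ 2) ≤ Real.log (1 - ξ i ^ 2) := by
    rw [← Finset.add_sum_erase _ _ (Finset.mem_univ i)]
    have := Finset.sum_nonpos (s := univ.erase i) fun j _ => log_term_nonpos (hξ.1 j)
    linarith
  linarith

lemma bound_two {k : ℕ} {ξ : Fin k → ℝ} (hξ : ξ ∈ Pk k) (m : ℕ) (h : m + 1 < k) :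
    π * redFk k ξ ≤ k * Real.log 2 + 2 * Real.log (ξ ⟨m+1, h⟩ - ξ ⟨m, by omega⟩) := by
  rw [pi_redFk hξ]
  have h1 := mul_le_mul_of_nonneg_left ((off_bound hξ).2 m h) Real.pi_pos.le
  set i : Fin k := ⟨m, by omega⟩
  set j : Fin k := ⟨m+1, h⟩
  have hij : i < j := by simp [i, j]
  have h2 : ∑ j, Real.log (1 - ξ j ^ 2) ≤ Real.log (1 - ξ i ^ 2) + Real.log (1 - ξ j ^ 2) := by
    rw [← Finset.add_sum_erase _ _ (Finset.mem_univ i),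
      ← Finset.add_sum_erase _ _ (Finset.mem_erase.2 ⟨hij.ne', Finset.mem_univ j⟩)]
    have := Finset.sum_nonpos (s := (univ.erase i).erase j) fun j _ => log_term_nonpos (hξ.1 j)
    linarith
  have h3 := greenG_lower (hξ.1 i) (hξ.1 j) (hξ.2 _ _ hij)
  linarith

lemma isOpen_Pk (k : ℕ) : IsOpen (Pk k) := by
  have : Pk k = (⋂ i, {ξ | -1 < ξ i} ∩ {ξ | ξ i < 1}) ∩
      ⋂ i, ⋂ j, ⋂ (_ : i < j), {ξ | ξ i < ξ j} := by
    ext ξ; simp [Pk, Set.mem_Ioo]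
  rw [this]
  refine IsOpen.inter (isOpen_iInter_of_finite fun i => IsOpen.inter ?_ ?_)
    (isOpen_iInter_of_finite fun i => isOpen_iInter_of_finite fun j =>
      isOpen_iInter_of_finite fun _ => ?_)
  · exact isOpen_lt continuous_const (continuous_apply i)
  · exact isOpen_lt (continuous_apply i) continuous_const
  · exact isOpen_lt (continuous_apply i) (continuous_apply j)

lemma Pk_nonempty (k : ℕ) : (Pk k).Nonempty := by
  refine ⟨fun i => (i:ℝ) / (k+1), fun i => ⟨?_, ?_⟩, fun i j h => ?_⟩
  · have : 0 ≤ (i:ℝ) / (k+1) := by positivity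
    linarith
  · rw [div_lt_one (by positivity)]
    have : ((i:ℕ):ℝ) < k := by exact_mod_cast i.2
    linarith
  · have : ((i:ℕ):ℝ) < (j:ℕ) := by exact_mod_cast h
    simp only
    gcongr

lemma frontier_nonempty {k : ℕ} (hk : 1 ≤ k) : (frontier (Pk k)).Nonempty := by
  rw [nonempty_frontier_iff]
  refine ⟨Pk_nonempty k, fun h => ?_⟩
  have : (fun _ => (2:ℝ) : Fin k → ℝ) ∈ Pk k := by rw [h]; trivial
  have := (this.1 ⟨0, hk⟩).2
  norm_num at this

lemma blowup (k : ℕ) (hk : 1 ≤ k) (M : ℝ) : ∃ ε > 0, ∀ ξ ∈ Pk k,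
        Metric.infDist ξ (frontier (Pk k)) < ε → redFk k ξ < M := by
  set C : ℝ := π * M - k * Real.log 2
  refine ⟨min (1/2) (Real.exp C / 2), by positivity, fun ξ hξ hd => ?_⟩
  set ε : ℝ := min (1/2) (Real.exp C / 2)
  have e1 : ε ≤ 1/2 := min_le_left _ _
  have e2 : ε ≤ Real.exp C / 2 := min_le_right _ _
  obtain ⟨y, hy, hyd⟩ := (Metric.infDist_lt_iff (frontier_nonempty hk)).1 hd
  have hyP : y ∉ Pk k := by
    rw [(isOpen_Pk k).frontier_eq] at hy; exact hy.2
  have hc : ∀ i, |ξ i - y i| < ε := fun i => by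
    rw [← Real.dist_eq]; exact (dist_le_pi_dist ξ y i).trans_lt hyd
  have fin : ∀ t : ℝ, 0 < t → t < 2 * ε → Real.log t < C := by
    intro t ht h
    rw [Real.log_lt_iff_lt_exp ht]; linarith
  suffices π * redFk k ξ < π * M from lt_of_mul_lt_mul_left this Real.pi_pos.le
  by_cases hA : ∀ i, y i ∈ Set.Ioo (-1:ℝ) 1
  · have : ∃ i j : Fin k, i < j ∧ y j ≤ y i := by
      by_contra! hh
      exact hyP ⟨hA, hh⟩
    obtain ⟨i, j, hij, hyij⟩ := this
    have hij' : (i:ℕ) < j := hij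
    have hl : (i:ℕ) + 1 < k := by have := j.2; omega
    have b := bound_two hξ i hl
    have g1 : ξ ⟨i+1, hl⟩ ≤ ξ j := by
      rcases (show (i:ℕ)+1 = j ∨ (i:ℕ)+1 < j by omega) with h | h
      · exact le_of_eq (congrArg ξ (Fin.ext h))
      · exact (hξ.2 _ _ (by simpa [Fin.lt_def] using h)).le
    have g2 : ξ i < ξ ⟨i+1, hl⟩ := hξ.2 _ _ (by simp [Fin.lt_def])
    have c1 := abs_lt.1 (hc i)
    have c2 := abs_lt.1 (hc j)
    have f := fin (ξ ⟨i+1, hl⟩ - ξ i) (by linarith) (by linarith [c1.1, c1.2, c2.1, c2.2])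
    have f2 : Real.log (ξ ⟨i+1, hl⟩ - ξ i) ≤ 0 :=
      Real.log_nonpos (by linarith) (by linarith [c1.1, c1.2, c2.1, c2.2])
    have b' : π * redFk k ξ ≤ k * Real.log 2 + 2 * Real.log (ξ ⟨i+1, hl⟩ - ξ i) := b
    simp only [C] at f
    linarith
  · push Not at hA
    obtain ⟨i, hi⟩ := hA
    have b := bound_one hξ i
    have c1 := abs_lt.1 (hc i)
    have x := hξ.1 i
    have f := fin (1 - ξ i ^ 2) (by nlinarith [x.1, x.2]) (by
      rw [Set.mem_Ioo, not_and_or, not_lt, not_lt] at hi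
      rcases hi with hi | hi
      · nlinarith [x.1, x.2, c1.1, c1.2]
      · nlinarith [x.1, x.2, c1.1, c1.2])
    simp only [C] at f
    linarith

lemma cont_redFk (k : ℕ) : ContinuousOn (redFk k) (Pk k) := by
  unfold redFk greenG
  refine ContinuousOn.add (continuousOn_finset_sum _ fun i _ => ?_)
    (continuousOn_finset_sum _ fun p hp => ?_)
  · refine continuousOn_const.mul (ContinuousOn.log (by fun_prop) fun ξ hξ => ?_)
    have x := hξ.1 i
    have : 0 < 1 - ξ i ^ 2 := by nlinarith [x.1, x.2]
    positivity
  · have hne : ∀ ξ ∈ Pk k, |ξ p.2 - ξ p.1| ≠ 0 := by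
      intro ξ hξ h
      have h := sub_eq_zero.1 (abs_eq_zero.1 h)
      rcases lt_or_gt_of_ne (Finset.mem_offDiag.1 hp).2.2 with h' | h'
      · exact (hξ.2 _ _ h').ne' h
      · exact (hξ.2 _ _ h').ne h
    refine continuousOn_const.mul (continuousOn_const.mul (ContinuousOn.log
      (ContinuousOn.div (by fun_prop) (by fun_prop) hne) fun ξ hξ => ?_))
    have x := hξ.1 p.1
    have y := hξ.1 p.2
    have : 0 < 1 - ξ p.1 * ξ p.2 := by nlinarith [x.1, x.2, y.1, y.2]
    refine div_ne_zero ?_ (hne ξ hξ)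
    positivity

theorem redFk_max_exists (k : ℕ) (hk : 1 ≤ k) :
    (∀ M : ℝ, ∃ ε > 0, ∀ ξ ∈ Pk k,
        Metric.infDist ξ (frontier (Pk k)) < ε → redFk k ξ < M) ∧
    (∃ ξ₀ ∈ Pk k, ∀ ξ ∈ Pk k, redFk k ξ ≤ redFk k ξ₀) ∧
    IsCompact {ξ ∈ Pk k | ∀ ζ ∈ Pk k, redFk k ζ ≤ redFk k ξ} := by
  refine ⟨blowup k hk, ?_⟩
  obtain ⟨ζ, hζ⟩ := Pk_nonempty k
  obtain ⟨ε, hε, hb⟩ := blowup k hk (redFk k ζ)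
  set K : Set (Fin k → ℝ) := closure (Pk k) ∩ {ξ | ε ≤ Metric.infDist ξ (frontier (Pk k))}
  have hKP : K ⊆ Pk k := by
    rintro ξ ⟨h1, h2⟩
    by_contra h
    have : ξ ∈ frontier (Pk k) := by rw [(isOpen_Pk k).frontier_eq]; exact ⟨h1, h⟩
    have := Metric.infDist_zero_of_mem this
    simp only [Set.mem_setOf_eq] at h2
    linarith
  have hbd : Bornology.IsBounded (Pk k) := by
    refine (Metric.isBounded_Icc (fun _ => (-1:ℝ) : Fin k → ℝ) (fun _ => 1)).subset ?_
    intro ξ hξ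
    exact ⟨fun i => (hξ.1 i).1.le, fun i => (hξ.1 i).2.le⟩
  have hK : IsCompact K := (hbd.isCompact_closure).inter_right
    (isClosed_le continuous_const (Metric.continuous_infDist_pt _))
  have hin : ∀ ξ ∈ Pk k, redFk k ζ ≤ redFk k ξ → ξ ∈ K := by
    intro ξ hξ h
    refine ⟨subset_closure hξ, ?_⟩
    by_contra h'
    exact absurd (hb ξ hξ (not_le.1 h')) (not_lt.2 h)
  have hc : ContinuousOn (redFk k) K := (cont_redFk k).mono hKP
  obtain ⟨ξ₀, h0, hmax⟩ := hK.exists_isMaxOn ⟨ζ, hin ζ hζ le_rfl⟩ hc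
  have hmax' : ∀ ξ ∈ Pk k, redFk k ξ ≤ redFk k ξ₀ := by
    intro ξ hξ
    rcases le_total (redFk k ζ) (redFk k ξ) with h | h
    · exact hmax (hin ξ hξ h)
    · exact h.trans (hmax (hin ζ hζ le_rfl))
  refine ⟨⟨ξ₀, hKP h0, hmax'⟩, ?_⟩
  have e : {ξ ∈ Pk k | ∀ ζ ∈ Pk k, redFk k ζ ≤ redFk k ξ} = K ∩ redFk k ⁻¹' Set.Ici (redFk k ξ₀) := by
    ext ξ
    constructor
    · rintro ⟨h1, h2⟩
      exact ⟨hin ξ h1 (h2 ζ hζ), h2 ξ₀ (hKP h0)⟩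
    · rintro ⟨h1, h2⟩
      exact ⟨hKP h1, fun η hη => (hmax' η hη).trans h2⟩
  rw [e]
  exact hK.of_isClosed_subset (hc.preimage_isClosed_of_isClosed hK.isClosed isClosed_Ici)
    Set.inter_subset_left
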